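/- arXiv:2206.00411 — 11 statements merged into one kernel-verified Lean document; each statement's English description precedes it below -/
import Mathlib

section
/- Let g be a Lie algebra and R : g → g a modified r-matrix. Then the bracket [x,y]_R := [R x, y] + [x, R y] defines a Lie algebra structure on the underlying vector space of g; that is, [·,·]_R is bilinear, alternating, and satisfies the Jacobi identity. -/
/-- The Jacobi identity in left-nested cyclic form. -/
theorem lie_lie_cyclic {L : Type*} [LieRing L] (a b c : L) :
    ⁅⁅a, b⁆, c⁆ + ⁅⁅b, c⁆, a⁆ + ⁅⁅c, a⁆, b⁆ = 0 := by
  rw [← lie_skew ⁅a, b⁆ c, ← lie_skew ⁅b, c⁆ a, ← lie_skew ⁅c, a⁆ b,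
    ← neg_add, ← neg_add, neg_eq_zero, ← lie_jacobi a b c]
  abel

/-- If `R` is a modified `r`-matrix on a Lie algebra `g`, then the bracket
`[x,y]_R = [R x, y] + [x, R y]` is bilinear, alternating and satisfies the Jacobi identity,
i.e. it defines a Lie algebra structure on the underlying vector space of `g`. -/
theorem modified_r_matrix_bracket_is_lie_algebra
    {K : Type*} [Field K] {g : Type*} [LieRing g] [LieAlgebra K g]
    (R : g →ₗ[K] g)
    (hR : ∀ x y : g, ⁅R x, R y⁆ = R (⁅R x, y⁆ + ⁅x, R y⁆) - ⁅x, y⁆) :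
    (∀ x x' y : g,
      ⁅R (x + x'), y⁆ + ⁅x + x', R y⁆ = (⁅R x, y⁆ + ⁅x, R y⁆) + (⁅R x', y⁆ + ⁅x', R y⁆)) ∧
    (∀ (c : K) (x y : g), ⁅R (c • x), y⁆ + ⁅c • x, R y⁆ = c • (⁅R x, y⁆ + ⁅x, R y⁆)) ∧
    (∀ x y y' : g,
      ⁅R x, y + y'⁆ + ⁅x, R (y + y')⁆ = (⁅R x, y⁆ + ⁅x, R y⁆) + (⁅R x, y'⁆ + ⁅x, R y'⁆)) ∧
    (∀ (c : K) (x y : g), ⁅R x, c • y⁆ + ⁅x, R (c • y)⁆ = c • (⁅R x, y⁆ + ⁅x, R y⁆)) ∧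
    (∀ x : g, ⁅R x, x⁆ + ⁅x, R x⁆ = 0) ∧
    (∀ x y z : g,
      (⁅R (⁅R x, y⁆ + ⁅x, R y⁆), z⁆ + ⁅⁅R x, y⁆ + ⁅x, R y⁆, R z⁆)
        + (⁅R (⁅R y, z⁆ + ⁅y, R z⁆), x⁆ + ⁅⁅R y, z⁆ + ⁅y, R z⁆, R x⁆)
        + (⁅R (⁅R z, x⁆ + ⁅z, R x⁆), y⁆ + ⁅⁅R z, x⁆ + ⁅z, R x⁆, R y⁆) = 0) := by
  have image_bracket (x y : g) : R (⁅R x, y⁆ + ⁅x, R y⁆) = ⁅R x, R y⁆ + ⁅x, y⁆ := by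
    rw [hR, sub_add_cancel]
  refine ⟨fun x x' y => ?_, fun c x y => ?_, fun x y y' => ?_, fun c x y => ?_, fun x => ?_,
    fun x y z => ?_⟩
  · simp only [map_add, add_lie]
    abel
  · simp only [map_smul, smul_lie, smul_add]
  · simp only [map_add, lie_add]
    abel
  · simp only [map_smul, lie_smul, smul_add]
  · rw [← lie_skew, neg_add_cancel]
  · simp only [image_bracket, add_lie]
    linear_combination (norm := abel) lie_lie_cyclic x y z + lie_lie_cyclic (R x) (R y) z +
      lie_lie_cyclic (R x) y (R z) + lie_lie_cyclic x (R y) (R z)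
end

section
/- Let R be a modified r-matrix on a Lie algebra (g, [·,·]). Define ρ : g → End(g) by ρ(x)y = [R x, y] - R([x, y]). Then ρ is a representation of the Lie algebra (g, [·,·]_R) on the vector space g; that is, for all x, y ∈ g, ρ([x,y]_R) = ρ(x) ∘ ρ(y) - ρ(y) ∘ ρ(x). -/
/-- The map `ρ(x) y = [R x, y] - R [x, y]`. -/
def modifiedRho {K : Type*} [Field K] {g : Type*} [LieRing g] [LieAlgebra K g]
    (R : g →ₗ[K] g) (x y : g) : g :=
  ⁅R x, y⁆ - R ⁅x, y⁆

/-- The composition `ρ(x) ∘ ρ(y)`, with the nested occurrences of `R` eliminated by the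
modified classical Yang-Baxter equation. -/
theorem modifiedRho_modifiedRho
    {K : Type*} [Field K] {g : Type*} [LieRing g] [LieAlgebra K g]
    (R : g →ₗ[K] g)
    (hR : ∀ x y : g, ⁅R x, R y⁆ = R (⁅R x, y⁆ + ⁅x, R y⁆) - ⁅x, y⁆) (x y z : g) :
    modifiedRho R x (modifiedRho R y z)
      = ⁅R x, ⁅R y, z⁆⁆ + ⁅x, ⁅y, z⁆⁆ - R ⁅R x, ⁅y, z⁆⁆ - R ⁅x, ⁅R y, z⁆⁆ := by
  simp only [modifiedRho, lie_sub, map_sub, hR x ⁅y, z⁆, map_add]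
  abel

/-- For a modified `r`-matrix `R`, the map `ρ(x) y = [R x, y] - R [x, y]` is a
representation of the Lie algebra `(g, [·,·]_R)` on the vector space `g`. -/
theorem modifiedRho_is_representation
    {K : Type*} [Field K] {g : Type*} [LieRing g] [LieAlgebra K g]
    (R : g →ₗ[K] g)
    (hR : ∀ x y : g, ⁅R x, R y⁆ = R (⁅R x, y⁆ + ⁅x, R y⁆) - ⁅x, y⁆) :
    ∀ x y z : g,
      modifiedRho R (⁅R x, y⁆ + ⁅x, R y⁆) z
        = modifiedRho R x (modifiedRho R y z) - modifiedRho R y (modifiedRho R x z) := by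
  intro x y z
  have h : R (⁅R x, y⁆ + ⁅x, R y⁆) = ⁅R x, R y⁆ + ⁅x, y⁆ := by rw [hR x y, sub_add_cancel]
  rw [modifiedRho_modifiedRho R hR, modifiedRho_modifiedRho R hR, modifiedRho, h]
  simp only [add_lie, lie_lie, map_add, map_sub]
  abel
end

section
/- Let R be a modified r-matrix on a Lie algebra (g, [·,·]) and R' : g → g a linear map. Then R + R' is a modified r-matrix if and only if for all x, y ∈ g: [R x, R' y] + [R' x, R y] - R([R' x, y] + [x, R' y]) - R'([R x, y] + [x, R y]) + [R' x, R' y] - R'([R' x, y] + [x, R' y]) = 0 (i.e., R' is a Maurer–Cartan element: d_R R' + (1/2)⟦R',R'⟧ = 0). -/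
/-- For a modified `r`-matrix `R` and a linear map `R'`, the sum `R + R'` is a
modified `r`-matrix if and only if `R'` is a Maurer–Cartan element, i.e.
`d_R R' + (1/2)⟦R',R'⟧ = 0`. -/
theorem add_isModifiedRMatrix_iff_maurerCartan
    {K : Type*} [Field K] {g : Type*} [LieRing g] [LieAlgebra K g]
    (R R' : g →ₗ[K] g)
    (hR : ∀ x y : g, ⁅R x, R y⁆ = R (⁅R x, y⁆ + ⁅x, R y⁆) - ⁅x, y⁆) :
    (∀ x y : g,
        ⁅(R + R') x, (R + R') y⁆
          = (R + R') (⁅(R + R') x, y⁆ + ⁅x, (R + R') y⁆) - ⁅x, y⁆)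
      ↔ (∀ x y : g,
          ⁅R x, R' y⁆ + ⁅R' x, R y⁆ - R (⁅R' x, y⁆ + ⁅x, R' y⁆)
            - R' (⁅R x, y⁆ + ⁅x, R y⁆) + ⁅R' x, R' y⁆ - R' (⁅R' x, y⁆ + ⁅x, R' y⁆) = 0) := by
  refine forall₂_congr fun x y => ?_
  have h := hR x y
  rw [← sub_eq_zero]
  rw [← sub_eq_zero] at h
  refine Eq.congr_left ?_
  rw [← sub_eq_zero, ← h]
  simp only [LinearMap.add_apply, add_lie, lie_add, map_add]
  abel
end

section
/- Let R be a modified r-matrix on a real Lie algebra (g, [·,·]) and R̂ : g → g a linear map. Suppose there exists ε > 0 such that R + t R̂ is a modified r-matrix for all t ∈ (-ε, ε). Then (1) R̂ is a 2-cocycle of R: [R x, R̂ y] - R([x, R̂ y]) - [R y, R̂ x] + R([y, R̂ x]) = R̂([R x, y] + [x, R y]) for all x, y ∈ g; and (2) R̂ satisfies [R̂ x, R̂ y] = R̂([R̂ x, y] + [x, R̂ y]) for all x, y ∈ g (i.e., R̂ is a Rota–Baxter operator of weight 0). -/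
/-- A quadratic polynomial in a real variable with vector coefficients and no constant term that
vanishes at `s` and `-s`, with `s ≠ 0`, has zero coefficients. -/
lemma eq_zero_and_eq_zero_of_smul_add_sq_smul_eq_zero
    {V : Type*} [AddCommGroup V] [Module ℝ V] {s : ℝ} (hs : s ≠ 0) {a b : V}
    (hpos : s • a + s ^ 2 • b = 0) (hneg : (-s) • a + (-s) ^ 2 • b = 0) : a = 0 ∧ b = 0 := by
  have ha : (2 * s) • a = 0 := by
    linear_combination (norm := module) hpos - hneg
  have hb : (2 * s ^ 2) • b = 0 := by
    linear_combination (norm := module) hpos + hneg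
  exact ⟨(smul_eq_zero.mp ha).resolve_left (by positivity),
    (smul_eq_zero.mp hb).resolve_left (by positivity)⟩

/-- If `R̂` generates a linear deformation of a modified `r`-matrix `R`
(i.e. `R + t R̂` is a modified `r`-matrix for all `t ∈ (-ε, ε)` with `ε > 0`), then `R̂` is a
`2`-cocycle of `R` and `R̂` is a Rota–Baxter operator of weight `0`. -/
theorem linear_deformation_generator_is_cocycle_and_weight_zero
    {g : Type*} [LieRing g] [LieAlgebra ℝ g]
    (R Rhat : g →ₗ[ℝ] g)
    (hR : ∀ x y : g, ⁅R x, R y⁆ = R (⁅R x, y⁆ + ⁅x, R y⁆) - ⁅x, y⁆)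
    (ε : ℝ) (hε : 0 < ε)
    (hdef : ∀ t ∈ Set.Ioo (-ε) ε, ∀ x y : g,
      ⁅(R + t • Rhat) x, (R + t • Rhat) y⁆
        = (R + t • Rhat) (⁅(R + t • Rhat) x, y⁆ + ⁅x, (R + t • Rhat) y⁆) - ⁅x, y⁆) :
    (∀ x y : g,
      ⁅R x, Rhat y⁆ - R ⁅x, Rhat y⁆ - ⁅R y, Rhat x⁆ + R ⁅y, Rhat x⁆
        = Rhat (⁅R x, y⁆ + ⁅x, R y⁆)) ∧
    (∀ x y : g, ⁅Rhat x, Rhat y⁆ = Rhat (⁅Rhat x, y⁆ + ⁅x, Rhat y⁆)) := by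
  have expand : ∀ t ∈ Set.Ioo (-ε) ε, ∀ x y : g,
      t • (⁅R x, Rhat y⁆ + ⁅Rhat x, R y⁆ - R (⁅Rhat x, y⁆ + ⁅x, Rhat y⁆)
          - Rhat (⁅R x, y⁆ + ⁅x, R y⁆))
        + t ^ 2 • (⁅Rhat x, Rhat y⁆ - Rhat (⁅Rhat x, y⁆ + ⁅x, Rhat y⁆)) = 0 := by
    intro t ht x y
    have h := hdef t ht x y
    have h₀ := hR x y
    simp only [LinearMap.add_apply, LinearMap.smul_apply, add_lie, lie_add, smul_lie, lie_smul,
      map_add, map_smul] at h h₀ ⊢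
    linear_combination (norm := module) h - h₀
  have coeff_eq_zero (x y : g) :=
    eq_zero_and_eq_zero_of_smul_add_sq_smul_eq_zero (half_pos hε).ne'
      (expand (ε / 2) ⟨by linarith, by linarith⟩ x y)
      (expand (-(ε / 2)) ⟨by linarith, by linarith⟩ x y)
  refine ⟨fun x y => ?_, fun x y => sub_eq_zero.mp (coeff_eq_zero x y).2⟩
  have h := (coeff_eq_zero x y).1
  rw [← lie_skew (Rhat x) (R y), ← lie_skew (Rhat x) y] at h
  simp only [map_add, map_neg] at h ⊢
  linear_combination (norm := module) h
end

section
/- Let R be a modified r-matrix on a real Lie algebra (g, [·,·]), and let R̂₁, R̂₂ : g → g be linear maps generating linear deformations R¹_t = R + t R̂₁ and R²_t = R + t R̂₂. Suppose there exists x ∈ g such that for all t ∈ ℝ the map φ_t = Id + t·ad_x satisfies φ_t([y,z]) = [φ_t(y), φ_t(z)] for all y, z ∈ g and R²_t ∘ φ_t = φ_t ∘ R¹_t. Then R̂₁ - R̂₂ = d_R x, i.e., R̂₁(u) - R̂₂(u) = [R u, x] - R([u, x]) for all u ∈ g; in particular [R̂₁] = [R̂₂] in H²(R). -/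
/-- If two linear deformations `R + t R̂₁` and `R + t R̂₂` of a modified `r`-matrix
`R` are equivalent via `φ_t = Id + t ad_x`, then `R̂₁ - R̂₂ = d_R x`, i.e.
`R̂₁ u - R̂₂ u = [R u, x] - R [u, x]`; in particular `[R̂₁] = [R̂₂]` in `H²(R)`. -/
theorem equivalent_linear_deformations_cohomologous
    {g : Type*} [LieRing g] [LieAlgebra ℝ g]
    (R Rhat₁ Rhat₂ : g →ₗ[ℝ] g)
    (hR : ∀ x y : g, ⁅R x, R y⁆ = R (⁅R x, y⁆ + ⁅x, R y⁆) - ⁅x, y⁆)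
    (ε₁ : ℝ) (hε₁ : 0 < ε₁)
    (hdef₁ : ∀ t ∈ Set.Ioo (-ε₁) ε₁, ∀ x y : g,
      ⁅(R + t • Rhat₁) x, (R + t • Rhat₁) y⁆
        = (R + t • Rhat₁) (⁅(R + t • Rhat₁) x, y⁆ + ⁅x, (R + t • Rhat₁) y⁆) - ⁅x, y⁆)
    (ε₂ : ℝ) (hε₂ : 0 < ε₂)
    (hdef₂ : ∀ t ∈ Set.Ioo (-ε₂) ε₂, ∀ x y : g,
      ⁅(R + t • Rhat₂) x, (R + t • Rhat₂) y⁆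
        = (R + t • Rhat₂) (⁅(R + t • Rhat₂) x, y⁆ + ⁅x, (R + t • Rhat₂) y⁆) - ⁅x, y⁆)
    (x : g)
    (hφlie : ∀ (t : ℝ) (y z : g),
      ⁅y, z⁆ + t • ⁅x, ⁅y, z⁆⁆ = ⁅y + t • ⁅x, y⁆, z + t • ⁅x, z⁆⁆)
    (hφR : ∀ (t : ℝ) (u : g),
      (R + t • Rhat₂) (u + t • ⁅x, u⁆)
        = (R + t • Rhat₁) u + t • ⁅x, (R + t • Rhat₁) u⁆) :
    ∀ u : g, Rhat₁ u - Rhat₂ u = ⁅R u, x⁆ - R ⁅u, x⁆ := by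
  intro u
  have hpos := hφR 1 u
  have hneg := hφR (-1) u
  simp only [LinearMap.add_apply, LinearMap.smul_apply, map_add, map_smul, lie_add,
    lie_smul] at hpos hneg
  rw [← lie_skew (R u) x, ← lie_skew u x, map_neg]
  have htwo : (2 : ℝ) • (Rhat₂ u + R ⁅x, u⁆ - Rhat₁ u - ⁅x, R u⁆) = 0 := by
    linear_combination (norm := module) hpos - hneg
  have hzero := (smul_eq_zero.mp htwo).resolve_left two_ne_zero
  linear_combination (norm := module) -hzero
end

section
/- Let R be a modified r-matrix on a real Lie algebra (g, [·,·]) and let x ∈ g be a Nijenhuis element associated to R. Then for every t ∈ ℝ: (1) R_t := R + t·(d_R x) is a modified r-matrix, where (d_R x)(u) = [R u, x] - R([u, x]); (2) φ_t := Id + t·ad_x satisfies φ_t([y,z]) = [φ_t(y), φ_t(z)] for all y, z ∈ g; and (3) R ∘ φ_t = φ_t ∘ R_t. That is, R_t is a trivial linear deformation of R. -/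
/-- The 1-coboundary `(d_R x)(u) = [R u, x] - R [u, x]`. -/
def dRone {g : Type*} [LieRing g] [LieAlgebra ℝ g] (R : g →ₗ[ℝ] g) (x u : g) : g :=
  ⁅R u, x⁆ - R ⁅u, x⁆

/-- The linear deformation `R_t = R + t (d_R x)`. -/
def Rdef {g : Type*} [LieRing g] [LieAlgebra ℝ g] (R : g →ₗ[ℝ] g) (x : g) (t : ℝ) (u : g) : g :=
  R u + t • dRone R x u

theorem dRone_eq {g : Type*} [LieRing g] [LieAlgebra ℝ g] (R : g →ₗ[ℝ] g) (x u : g) :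
    dRone R x u = R ⁅x, u⁆ - ⁅x, R u⁆ := by
  rw [dRone, ← lie_skew (R u) x, ← lie_skew u x, map_neg]
  abel

/-- Coboundaries `d_R x` are cocycles for the linearised modified Yang-Baxter equation. -/
theorem dRone_cocycle {g : Type*} [LieRing g] [LieAlgebra ℝ g] (R : g →ₗ[ℝ] g)
    (hR : ∀ x y : g, ⁅R x, R y⁆ = R (⁅R x, y⁆ + ⁅x, R y⁆) - ⁅x, y⁆) (x u v : g) :
    ⁅dRone R x u, R v⁆ + ⁅R u, dRone R x v⁆
      = dRone R x (⁅R u, v⁆ + ⁅u, R v⁆) + R (⁅dRone R x u, v⁆ + ⁅u, dRone R x v⁆) := by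
  have h := congrArg (fun w => ⁅x, w⁆) (hR u v)
  have h₁ := hR ⁅x, u⁆ v
  have h₂ := hR u ⁅x, v⁆
  simp only [dRone_eq, lie_sub, sub_lie, lie_add, map_add, map_sub, leibniz_lie x (R u) (R v),
    leibniz_lie x u v, leibniz_lie x (R u) v, leibniz_lie x u (R v)] at h h₁ h₂ ⊢
  linear_combination (norm := module) h₁ + h₂ - h

/-- The defect of `R_t` in the modified Yang-Baxter equation is quadratic in `t`. -/
theorem Rdef_defect {g : Type*} [LieRing g] [LieAlgebra ℝ g] (R : g →ₗ[ℝ] g)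
    (hR : ∀ x y : g, ⁅R x, R y⁆ = R (⁅R x, y⁆ + ⁅x, R y⁆) - ⁅x, y⁆) (x : g) (t : ℝ) (u v : g) :
    ⁅Rdef R x t u, Rdef R x t v⁆
        - (Rdef R x t (⁅Rdef R x t u, v⁆ + ⁅u, Rdef R x t v⁆) - ⁅u, v⁆)
      = t ^ 2 • (⁅dRone R x u, dRone R x v⁆
          - dRone R x (⁅dRone R x u, v⁆ + ⁅u, dRone R x v⁆)) := by
  have hadd : ∀ a b : g, dRone R x (a + b) = dRone R x a + dRone R x b := fun a b => by
    simp only [dRone_eq, lie_add, map_add]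
    abel
  have hsmul : ∀ (r : ℝ) (a : g), dRone R x (r • a) = r • dRone R x a := fun r a => by
    simp only [dRone_eq, lie_smul, map_smul, smul_sub]
  have h₀ := hR u v
  have h₁ := dRone_cocycle R hR x u v
  simp only [Rdef, lie_add, add_lie, lie_smul, smul_lie, map_add, map_smul, hadd, hsmul]
    at h₀ h₁ ⊢
  linear_combination (norm := module) h₀ + t • h₁

/-- If `x` is a Nijenhuis element associated to a modified `r`-matrix `R`, then
`R_t = R + t (d_R x)` is a trivial linear deformation of `R`: for every `t ∈ ℝ`, `R_t` is a
modified `r`-matrix, `φ_t = Id + t ad_x` preserves the bracket, and `R ∘ φ_t = φ_t ∘ R_t`. -/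
theorem nijenhuis_element_gives_trivial_linear_deformation
    {g : Type*} [LieRing g] [LieAlgebra ℝ g]
    (R : g →ₗ[ℝ] g)
    (hR : ∀ x y : g, ⁅R x, R y⁆ = R (⁅R x, y⁆ + ⁅x, R y⁆) - ⁅x, y⁆)
    (x : g)
    (hN1 : ∀ y z : g, ⁅⁅x, y⁆, ⁅x, z⁆⁆ = 0)
    (hN2 : ∀ y : g, ⁅x, ⁅x, R y⁆⁆ = ⁅x, R ⁅x, y⁆⁆) :
    ∀ t : ℝ,
      (∀ u v : g,
        ⁅Rdef R x t u, Rdef R x t v⁆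
          = Rdef R x t (⁅Rdef R x t u, v⁆ + ⁅u, Rdef R x t v⁆) - ⁅u, v⁆) ∧
      (∀ y z : g, ⁅y, z⁆ + t • ⁅x, ⁅y, z⁆⁆ = ⁅y + t • ⁅x, y⁆, z + t • ⁅x, z⁆⁆) ∧
      (∀ u : g, R (u + t • ⁅x, u⁆) = Rdef R x t u + t • ⁅x, Rdef R x t u⁆) := by
  have hφ : ∀ (t : ℝ) (y z : g),
      ⁅y, z⁆ + t • ⁅x, ⁅y, z⁆⁆ = ⁅y + t • ⁅x, y⁆, z + t • ⁅x, z⁆⁆ := fun t y z => by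
    simp only [lie_add, add_lie, lie_smul, smul_lie, hN1, leibniz_lie x y z]
    module
  have hφR : ∀ (t : ℝ) (u : g),
      R (u + t • ⁅x, u⁆) = Rdef R x t u + t • ⁅x, Rdef R x t u⁆ := fun t u => by
    have h : ⁅x, dRone R x u⁆ = 0 := by rw [dRone_eq, lie_sub, hN2, sub_self]
    simp only [Rdef, lie_add, lie_smul, h, map_add, map_smul]
    rw [dRone_eq]
    module
  refine fun t => ⟨fun u v => ?_, hφ t, hφR t⟩
  rw [← sub_eq_zero, Rdef_defect R hR]
  set E := ⁅dRone R x u, dRone R x v⁆ - dRone R x (⁅dRone R x u, v⁆ + ⁅u, dRone R x v⁆) with hE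
  -- `φ_s` intertwines `R_s` with `R`, so it kills the defect of `R_s`.
  have key : ∀ s : ℝ, s ^ 2 • E + s • ⁅x, s ^ 2 • E⁆ = 0 := fun s => by
    have h := hR (u + s • ⁅x, u⁆) (v + s • ⁅x, v⁆)
    have h₁ := hφR s (⁅Rdef R x s u, v⁆ + ⁅u, Rdef R x s v⁆)
    have h₂ : ⁅Rdef R x s u, v⁆ + ⁅u, Rdef R x s v⁆
          + s • ⁅x, ⁅Rdef R x s u, v⁆ + ⁅u, Rdef R x s v⁆⁆
        = (⁅Rdef R x s u, v⁆ + s • ⁅x, ⁅Rdef R x s u, v⁆⁆)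
          + (⁅u, Rdef R x s v⁆ + s • ⁅x, ⁅u, Rdef R x s v⁆⁆) := by
      rw [lie_add]
      module
    rw [hφR, hφR, ← hφ, ← hφ, ← hφ, ← hφ, ← h₂, h₁] at h
    rw [hE, ← Rdef_defect R hR, lie_sub, lie_sub]
    linear_combination (norm := module) h
  have h₁ := key 1
  have h₂ := key (-1)
  have hE0 : E = 0 := by
    simp only [lie_smul] at h₁ h₂
    linear_combination (norm := module) (1 / 2 : ℝ) • h₁ + (1 / 2 : ℝ) • h₂
  rw [hE0, smul_zero]
end

section
/- Let R be a modified r-matrix on a Lie algebra (g, [·,·]) and let x ∈ g be a Nijenhuis element associated to R. Then ad_x is a Nijenhuis operator on the Lie algebra (g, [·,·]_R); that is, for all y, z ∈ g: [[x,y], [x,z]]_R = [x, [[x,y], z]_R + [y, [x,z]]_R] - [x, [x, [y,z]_R]]. -/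
/-- If `x` is a Nijenhuis element associated to a modified `r`-matrix `R`, then
`ad_x` is a Nijenhuis operator on the Lie algebra `(g, [·,·]_R)`. -/
theorem ad_of_nijenhuis_element_is_nijenhuis_operator
    {K : Type*} [Field K] {g : Type*} [LieRing g] [LieAlgebra K g]
    (R : g →ₗ[K] g)
    (hR : ∀ x y : g, ⁅R x, R y⁆ = R (⁅R x, y⁆ + ⁅x, R y⁆) - ⁅x, y⁆)
    (x : g)
    (hN1 : ∀ y z : g, ⁅⁅x, y⁆, ⁅x, z⁆⁆ = 0)
    (hN2 : ∀ y : g, ⁅x, ⁅x, R y⁆⁆ = ⁅x, R ⁅x, y⁆⁆) :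
    ∀ y z : g,
      ⁅R ⁅x, y⁆, ⁅x, z⁆⁆ + ⁅⁅x, y⁆, R ⁅x, z⁆⁆
        = ⁅x, (⁅R ⁅x, y⁆, z⁆ + ⁅⁅x, y⁆, R z⁆) + (⁅R y, ⁅x, z⁆⁆ + ⁅y, R ⁅x, z⁆⁆)⁆
          - ⁅x, ⁅x, ⁅R y, z⁆ + ⁅y, R z⁆⁆⁆ := by
  intro y z
  simp only [lie_add, leibniz_lie x (R y) _, leibniz_lie x y _, leibniz_lie x ⁅x, y⁆ _,
    leibniz_lie x ⁅x, R y⁆ _, leibniz_lie x (R ⁅x, y⁆) _, hN1, hN2]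
  abel
end

section
/- Let R be a modified r-matrix on a Lie algebra (g, [·,·]) over a field of characteristic zero. In the direct-product Lie algebra g ⊕ g, the diagonal g_Δ = {(x,x) : x ∈ g} and the graph G(R̂) = { (x - R x, -R x - x) : x ∈ g } are both Lie subalgebras, their intersection is zero, and g ⊕ g = g_Δ + G(R̂); hence g ⊕ g decomposes as a direct sum of the Lie subalgebras g_Δ and G(R̂) (so (g_Δ, G(R̂)) is a matched pair of Lie algebras). -/
/-- The diagonal `g_Δ = {(x,x) : x ∈ g}` as a submodule of `g × g`. -/
def diagSubmodule (K : Type*) [Field K] (g : Type*) [LieRing g] [LieAlgebra K g] :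
    Submodule K (g × g) :=
  LinearMap.range ((LinearMap.id : g →ₗ[K] g).prod (LinearMap.id : g →ₗ[K] g))

/-- The graph `G(R̂) = {(x - R x, -R x - x) : x ∈ g}` as a submodule of `g × g`. -/
def graphSubmodule {K : Type*} [Field K] {g : Type*} [LieRing g] [LieAlgebra K g]
    (R : g →ₗ[K] g) : Submodule K (g × g) :=
  LinearMap.range ((LinearMap.id - R).prod (-(R + LinearMap.id)))

/-- For a modified `r`-matrix `R` on a Lie algebra `g` over a field of
characteristic zero, the diagonal `g_Δ` and the graph `G(R̂)` are Lie subalgebras of the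
direct-product Lie algebra `g ⊕ g`, their intersection is zero, and their sum is everything:
`g ⊕ g = g_Δ ⊕ G(R̂)` (so they form a matched pair of Lie algebras). -/
theorem diagonal_and_graph_matched_pair
    {K : Type*} [Field K] [CharZero K] {g : Type*} [LieRing g] [LieAlgebra K g]
    (R : g →ₗ[K] g)
    (hR : ∀ x y : g, ⁅R x, R y⁆ = R (⁅R x, y⁆ + ⁅x, R y⁆) - ⁅x, y⁆) :
    (∀ p ∈ diagSubmodule K g, ∀ q ∈ diagSubmodule K g,
      (⁅p.1, q.1⁆, ⁅p.2, q.2⁆) ∈ diagSubmodule K g) ∧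
    (∀ p ∈ graphSubmodule R, ∀ q ∈ graphSubmodule R,
      (⁅p.1, q.1⁆, ⁅p.2, q.2⁆) ∈ graphSubmodule R) ∧
    diagSubmodule K g ⊓ graphSubmodule R = ⊥ ∧
    diagSubmodule K g ⊔ graphSubmodule R = ⊤ := by
  refine ⟨?_, ?_, ?_, ?_⟩
  · rintro _ ⟨x, rfl⟩ _ ⟨y, rfl⟩
    exact ⟨⁅x, y⁆, rfl⟩
  · rintro _ ⟨x, rfl⟩ _ ⟨y, rfl⟩
    refine ⟨-(⁅R x, y⁆ + ⁅x, R y⁆), Prod.ext ?_ ?_⟩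
    · change -(⁅R x, y⁆ + ⁅x, R y⁆) - R (-(⁅R x, y⁆ + ⁅x, R y⁆)) = ⁅x - R x, y - R y⁆
      simp only [map_neg, sub_lie, lie_sub, hR]
      abel
    · change -(R (-(⁅R x, y⁆ + ⁅x, R y⁆)) + -(⁅R x, y⁆ + ⁅x, R y⁆)) =
        ⁅-(R x + x), -(R y + y)⁆
      simp only [map_neg, neg_lie, lie_neg, add_lie, lie_add, hR]
      abel
  · rw [eq_bot_iff]
    rintro _ ⟨⟨x, rfl⟩, y, hy⟩
    have h₁ : y - R y = x := congrArg Prod.fst hy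
    have h₂ : -(R y + y) = x := congrArg Prod.snd hy
    have h : (2 : K) • y = 0 := by
      rw [two_smul, ← sub_eq_zero.mpr (h₁.trans h₂.symm)]
      abel
    have y_zero : y = 0 := (smul_eq_zero.mp h).resolve_left two_ne_zero
    rw [← hy, y_zero, map_zero]
    exact Submodule.zero_mem _
  · rw [eq_top_iff]
    rintro ⟨a, b⟩ -
    set x : g := (2 : K)⁻¹ • (a - b) with hx
    have h : x + x = a - b := by
      rw [← two_smul K x, hx, smul_inv_smul₀ two_ne_zero]
    refine Submodule.mem_sup.mpr
      ⟨_, ⟨a - (x - R x), rfl⟩, _, ⟨x, rfl⟩, Prod.ext ?_ ?_⟩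
    · change a - (x - R x) + (x - R x) = a
      abel
    · change a - (x - R x) + -(R x + x) = b
      calc
        a - (x - R x) + -(R x + x) = a - (x + x) := by abel
        _ = b := by rw [h, sub_sub_cancel]
end

section
/- Let R be a modified r-matrix on a real Lie algebra (g, [·,·]) and R̂ : g → g a linear map such that R_t := R + t R̂ is a modified r-matrix for all t ∈ ℝ. Then for any t₁, t₂ ∈ ℝ, the bilinear bracket (x,y) ↦ [x,y]_{R_{t₁}} + [x,y]_{R_{t₂}} satisfies the Jacobi identity, i.e., it defines a Lie algebra structure on g (equivalently, the linear Poisson structures on g* induced by [·,·]_{R_{t₁}} and [·,·]_{R_{t₂}} are compatible). -/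
/-- The Lie bracket `[x,y]_S = [S x, y] + [x, S y]` induced by a modified `r`-matrix `S`. -/
def inducedBracket {g : Type*} [LieRing g] [LieAlgebra ℝ g]
    (S : g →ₗ[ℝ] g) (x y : g) : g :=
  ⁅S x, y⁆ + ⁅x, S y⁆

/-- The bracket induced by a modified `r`-matrix satisfies the Jacobi identity. -/
theorem inducedBracket_jacobi {g : Type*} [LieRing g] [LieAlgebra ℝ g] (S : g →ₗ[ℝ] g)
    (hS : ∀ x y : g, ⁅S x, S y⁆ = S (⁅S x, y⁆ + ⁅x, S y⁆) - ⁅x, y⁆) (x y z : g) :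
    inducedBracket S (inducedBracket S x y) z + inducedBracket S (inducedBracket S y z) x
      + inducedBracket S (inducedBracket S z x) y = 0 := by
  have hS' (x y : g) : S (⁅S x, y⁆ + ⁅x, S y⁆) = ⁅S x, S y⁆ + ⁅x, y⁆ := by
    rw [hS, sub_add_cancel]
  have jacobi (a b c : g) : ⁅⁅a, b⁆, c⁆ + ⁅⁅b, c⁆, a⁆ + ⁅⁅c, a⁆, b⁆ = 0 := by
    rw [← neg_eq_zero, ← lie_jacobi a b c, ← lie_skew ⁅a, b⁆ c, ← lie_skew ⁅b, c⁆ a,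
      ← lie_skew ⁅c, a⁆ b]
    abel
  simp only [inducedBracket, hS', add_lie]
  linear_combination (norm := abel) jacobi x y z + jacobi (S x) (S y) z + jacobi (S x) y (S z)
    + jacobi x (S y) (S z)

/-- The brackets induced by `R + t₁ • Rhat` and `R + t₂ • Rhat` add up to twice the bracket induced
at the midpoint of `t₁` and `t₂`. -/
theorem inducedBracket_add_eq_two_smul {g : Type*} [LieRing g] [LieAlgebra ℝ g]
    (R Rhat : g →ₗ[ℝ] g) (t₁ t₂ : ℝ) (x y : g) :
    inducedBracket (R + t₁ • Rhat) x y + inducedBracket (R + t₂ • Rhat) x y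
      = (2 : ℝ) • inducedBracket (R + ((t₁ + t₂) / 2) • Rhat) x y := by
  simp only [inducedBracket, LinearMap.add_apply, LinearMap.smul_apply, add_lie, lie_add, smul_lie,
    lie_smul]
  module

theorem inducedBracket_smul_left {g : Type*} [LieRing g] [LieAlgebra ℝ g]
    (S : g →ₗ[ℝ] g) (c : ℝ) (x y : g) :
    inducedBracket S (c • x) y = c • inducedBracket S x y := by
  simp only [inducedBracket, map_smul, smul_lie, smul_add]

/-- If `R_t = R + t R̂` is a modified `r`-matrix for all `t ∈ ℝ`, then for any
`t₁, t₂` the bracket `(x,y) ↦ [x,y]_{R_{t₁}} + [x,y]_{R_{t₂}}` satisfies the Jacobi identity,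
i.e. it defines a Lie algebra structure on `g` (equivalently, the induced linear Poisson
structures on `g*` are compatible). -/
theorem linear_deformation_gives_compatible_poisson_structures
    {g : Type*} [LieRing g] [LieAlgebra ℝ g]
    (R Rhat : g →ₗ[ℝ] g)
    (hR : ∀ x y : g, ⁅R x, R y⁆ = R (⁅R x, y⁆ + ⁅x, R y⁆) - ⁅x, y⁆)
    (hdef : ∀ t : ℝ, ∀ x y : g,
      ⁅(R + t • Rhat) x, (R + t • Rhat) y⁆
        = (R + t • Rhat) (⁅(R + t • Rhat) x, y⁆ + ⁅x, (R + t • Rhat) y⁆) - ⁅x, y⁆) :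
    ∀ t₁ t₂ : ℝ, ∀ x y z : g,
      (inducedBracket (R + t₁ • Rhat)
          (inducedBracket (R + t₁ • Rhat) x y + inducedBracket (R + t₂ • Rhat) x y) z
        + inducedBracket (R + t₂ • Rhat)
          (inducedBracket (R + t₁ • Rhat) x y + inducedBracket (R + t₂ • Rhat) x y) z)
      + (inducedBracket (R + t₁ • Rhat)
          (inducedBracket (R + t₁ • Rhat) y z + inducedBracket (R + t₂ • Rhat) y z) x
        + inducedBracket (R + t₂ • Rhat)
          (inducedBracket (R + t₁ • Rhat) y z + inducedBracket (R + t₂ • Rhat) y z) x)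
      + (inducedBracket (R + t₁ • Rhat)
          (inducedBracket (R + t₁ • Rhat) z x + inducedBracket (R + t₂ • Rhat) z x) y
        + inducedBracket (R + t₂ • Rhat)
          (inducedBracket (R + t₁ • Rhat) z x + inducedBracket (R + t₂ • Rhat) z x) y) = 0 := by
  intro t₁ t₂ x y z
  simp only [inducedBracket_add_eq_two_smul, inducedBracket_smul_left, ← smul_add]
  rw [inducedBracket_jacobi _ (hdef _), smul_zero, smul_zero]
end

section
/- Let (g, [·,·]) be a Lie algebra over a field of characteristic zero and R : g → g a linear map with R² = Id. Then the following are equivalent: (1) R is a modified r-matrix; (2) R is a Nijenhuis operator, i.e., [R x, R y] = R([R x, y] + [x, R y]) - R²([x,y]) for all x, y; (3) the eigenspaces g₁ = {x : R x = x} and g₂ = {x : R x = -x} are Lie subalgebras of g (and g = g₁ ⊕ g₂ with R(x+u) = x - u for x ∈ g₁, u ∈ g₂). -/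
/-- For a linear map `R` with `R² = Id` on a Lie algebra over a field of
characteristic zero, the following are equivalent: (1) `R` is a modified `r`-matrix;
(2) `R` is a Nijenhuis operator; (3) the eigenspaces `g₁ = ker(R - Id)` and `g₂ = ker(R + Id)`
are Lie subalgebras (and `g = g₁ ⊕ g₂`, with `R(x + u) = x - u` for `x ∈ g₁`, `u ∈ g₂`). -/
theorem involution_modified_r_matrix_tfae
    {K : Type*} [Field K] [CharZero K] {g : Type*} [LieRing g] [LieAlgebra K g]
    (R : g →ₗ[K] g) (hinv : ∀ x : g, R (R x) = x) :
    ((∀ x y : g, ⁅R x, R y⁆ = R (⁅R x, y⁆ + ⁅x, R y⁆) - ⁅x, y⁆)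
      ↔ (∀ x y : g, ⁅R x, R y⁆ = R (⁅R x, y⁆ + ⁅x, R y⁆) - R (R ⁅x, y⁆)))
    ∧
    ((∀ x y : g, ⁅R x, R y⁆ = R (⁅R x, y⁆ + ⁅x, R y⁆) - ⁅x, y⁆)
      ↔ ((∀ x y : g, R x = x → R y = y → R ⁅x, y⁆ = ⁅x, y⁆)
          ∧ (∀ u v : g, R u = -u → R v = -v → R ⁅u, v⁆ = -⁅u, v⁆)
          ∧ (∀ z : g, ∃ x u : g, R x = x ∧ R u = -u ∧ z = x + u))) := by
  refine ⟨by simp only [hinv], fun h => ⟨fun x y hx hy => ?_, fun u v hu hv => ?_, fun z => ?_⟩, ?_⟩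
  · have e := h x y
    rw [hx, hy, map_add] at e
    have e' : (2 : K) • R ⁅x, y⁆ = (2 : K) • ⁅x, y⁆ := by
      rw [two_smul, two_smul]
      exact (eq_sub_iff_add_eq.mp e).symm
    exact smul_right_injective g (two_ne_zero (α := K)) e'
  · have e := h u v
    rw [hu, hv, map_add] at e
    simp only [neg_lie, lie_neg, neg_neg, map_neg] at e
    have e' : (2 : K) • R ⁅u, v⁆ = (2 : K) • -⁅u, v⁆ := by
      rw [two_smul, two_smul]
      have := eq_sub_iff_add_eq.mp e
      rw [← neg_add, this]
      abel
    exact smul_right_injective g (two_ne_zero (α := K)) e'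
  · refine ⟨(2 : K)⁻¹ • (z + R z), (2 : K)⁻¹ • (z - R z), ?_, ?_, ?_⟩
    · rw [map_smul, map_add, hinv, add_comm]
    · rw [map_smul, map_sub, hinv, ← smul_neg, neg_sub]
    · rw [← smul_add, add_add_sub_cancel, ← two_smul K z, inv_smul_smul₀ two_ne_zero]
  · rintro ⟨h₁, h₂, hd⟩ x y
    obtain ⟨a, u, ha, hu, rfl⟩ := hd x
    obtain ⟨b, v, hb, hv, rfl⟩ := hd y
    have hab := h₁ a b ha hb
    have huv := h₂ u v hu hv
    simp only [map_add, ha, hu, hb, hv, lie_add, add_lie, neg_lie, lie_neg, map_neg, hab, huv]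
    abel
end

section
/- Let n ≥ 2 and let g = sl(n, ℝ) be the Lie algebra of traceless n×n real matrices with the commutator bracket. Define R : g → g by (R A)_{ij} = A_{ij} if i ≤ j and (R A)_{ij} = -A_{ij} if i > j (i.e., R = Id on the Borel subalgebra of upper-triangular traceless matrices and R = -Id on the strictly lower-triangular matrices); R is a modified r-matrix. Then for a ∈ g, the 1-cocycle condition d_R a = 0 (i.e., [R y, a] = R([y, a]) for all y ∈ g) holds if and only if a is a diagonal (traceless) matrix. Consequently H¹(R) is isomorphic to ℝ^{n-1}. -/
open Matrix

noncomputable section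

/-- The linear map on matrices which is the identity on upper-triangular entries and
minus the identity on strictly lower-triangular entries. -/
def borelReflect (n : ℕ) :
    Matrix (Fin n) (Fin n) ℝ →ₗ[ℝ] Matrix (Fin n) (Fin n) ℝ where
  toFun A := Matrix.of fun i j => if i ≤ j then A i j else -A i j
  map_add' A B := by
    ext i j
    simp only [Matrix.of_apply, Matrix.add_apply]
    split <;> ring
  map_smul' c A := by
    ext i j
    simp only [Matrix.of_apply, Matrix.smul_apply, RingHom.id_apply, smul_eq_mul]
    split <;> ring

theorem borelReflect_apply (n : ℕ) (A : Matrix (Fin n) (Fin n) ℝ) (i j : Fin n) :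
    borelReflect n A i j = if i ≤ j then A i j else -A i j := rfl

theorem trace_borelReflect (n : ℕ) (A : Matrix (Fin n) (Fin n) ℝ) :
    (borelReflect n A).trace = A.trace := by
  simp [Matrix.trace, Matrix.diag, borelReflect_apply]

/-- The modified `r`-matrix on `sl(n, ℝ)` which is the identity on the Borel subalgebra of
upper-triangular traceless matrices and minus the identity on strictly lower-triangular
matrices. -/
def Rsl (n : ℕ) :
    (LieAlgebra.SpecialLinear.sl (Fin n) ℝ) →ₗ[ℝ] (LieAlgebra.SpecialLinear.sl (Fin n) ℝ) where
  toFun A := ⟨borelReflect n A.val, by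
    have hA : Matrix.trace A.val = 0 := A.2
    show borelReflect n A.val ∈ LinearMap.ker (Matrix.traceLinearMap (Fin n) ℝ ℝ)
    rw [LinearMap.mem_ker]
    show (borelReflect n A.val).trace = 0
    rw [trace_borelReflect, hA]⟩
  map_add' A B := Subtype.ext (by simp)
  map_smul' c A := Subtype.ext ((borelReflect n).map_smul c A.val)

/-- The space of `1`-cocycles `{a ∈ sl(n,ℝ) : d_R a = 0}`, which equals `H¹(R)` since the
space of `0`-cochains is zero. -/
def slCocycles (n : ℕ) : Submodule ℝ (LieAlgebra.SpecialLinear.sl (Fin n) ℝ) where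
  carrier := {a | ∀ y, ⁅Rsl n y, a⁆ = Rsl n ⁅y, a⁆}
  add_mem' := by
    intro a b ha hb y
    rw [lie_add, ha y, hb y, ← map_add, ← lie_add]
  zero_mem' := by
    intro y
    rw [lie_zero, lie_zero, map_zero]
  smul_mem' := by
    intro c a ha y
    rw [lie_smul, ha y, ← _root_.map_smul (Rsl n), ← lie_smul]

theorem borelReflect_mul_borelReflect (n : ℕ) (A B : Matrix (Fin n) (Fin n) ℝ) :
    borelReflect n A * borelReflect n B =
      borelReflect n (borelReflect n A * B + A * borelReflect n B) - A * B := by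
  ext i j
  have key : ∀ k, borelReflect n A i k * borelReflect n B k j =
      (if i ≤ j then (1 : ℝ) else -1) *
        (borelReflect n A i k * B k j + A i k * borelReflect n B k j) - A i k * B k j := by
    intro k
    simp only [borelReflect_apply]
    split_ifs <;> first | (exfalso; order) | ring
  rw [Matrix.sub_apply, borelReflect_apply]
  simp only [Matrix.add_apply, Matrix.mul_apply]
  rw [Finset.sum_congr rfl fun k _ => key k, Finset.sum_sub_distrib, ← Finset.mul_sum,
    Finset.sum_add_distrib]
  split_ifs <;> ring

theorem Rsl_val (n : ℕ) (x : LieAlgebra.SpecialLinear.sl (Fin n) ℝ) :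
    (Rsl n x).val = borelReflect n x.val := rfl

theorem sl_lie_val (n : ℕ) (x y : LieAlgebra.SpecialLinear.sl (Fin n) ℝ) :
    (⁅x, y⁆ : LieAlgebra.SpecialLinear.sl (Fin n) ℝ).val = x.val * y.val - y.val * x.val := rfl

theorem Rsl_modified_yang_baxter (n : ℕ) (x y : LieAlgebra.SpecialLinear.sl (Fin n) ℝ) :
    ⁅Rsl n x, Rsl n y⁆ = Rsl n (⁅Rsl n x, y⁆ + ⁅x, Rsl n y⁆) - ⁅x, y⁆ := by
  apply Subtype.ext
  change borelReflect n x.val * borelReflect n y.val - borelReflect n y.val * borelReflect n x.val =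
    borelReflect n ((borelReflect n x.val * y.val - y.val * borelReflect n x.val) +
      (x.val * borelReflect n y.val - borelReflect n y.val * x.val)) -
      (x.val * y.val - y.val * x.val)
  rw [borelReflect_mul_borelReflect n x.val y.val, borelReflect_mul_borelReflect n y.val x.val]
  simp only [map_add, map_sub]
  abel

/-- A traceless matrix, as an element of `sl(n, ℝ)`. -/
def slOfTrace {n : ℕ} (A : Matrix (Fin n) (Fin n) ℝ) (hA : A.trace = 0) :
    LieAlgebra.SpecialLinear.sl (Fin n) ℝ :=
  ⟨A, LinearMap.mem_ker.2 hA⟩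

theorem isCocycle_iff_diagonal (n : ℕ) (a : LieAlgebra.SpecialLinear.sl (Fin n) ℝ) :
    (∀ y : LieAlgebra.SpecialLinear.sl (Fin n) ℝ, ⁅Rsl n y, a⁆ = Rsl n ⁅y, a⁆) ↔
      ∀ i j : Fin n, i ≠ j → a.val i j = 0 := by
  constructor
  · intro h i j hij
    have entry : ∀ (A : Matrix (Fin n) (Fin n) ℝ), A.trace = 0 → ∀ p q,
        (borelReflect n A * a.val - a.val * borelReflect n A) p q =
          borelReflect n (A * a.val - a.val * A) p q := fun A hA p q =>
      congrFun (congrFun (congrArg Subtype.val (h (slOfTrace A hA))) p) q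
    rcases lt_or_gt_of_ne hij with hlt | hgt
    · have hR : borelReflect n (Matrix.single j i 1) = -Matrix.single j i 1 := by
        ext p q
        rw [borelReflect_apply, Matrix.neg_apply]
        split_ifs with hpq
        · have : ¬(j = p ∧ i = q) := by rintro ⟨rfl, rfl⟩; order
          rw [Matrix.single_apply, if_neg this, neg_zero]
        · rfl
      have := entry (Matrix.single j i 1) (Matrix.trace_single_eq_of_ne j i 1 hij.symm) j j
      rw [hR, borelReflect_apply, if_pos le_rfl] at this
      simp [Matrix.sub_apply, hij.symm] at this
      linarith
    · have hR : borelReflect n (Matrix.diagonal (Pi.single i 1 - Pi.single j 1)) =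
          Matrix.diagonal (Pi.single i 1 - Pi.single j 1) := by
        ext p q
        rw [borelReflect_apply]
        split_ifs with hpq
        · rfl
        · rw [Matrix.diagonal_apply_ne _ (by rintro rfl; exact hpq le_rfl), neg_zero]
      have := entry (Matrix.diagonal (Pi.single i 1 - Pi.single j 1))
        (by simp [Matrix.trace_diagonal]) i j
      rw [hR, borelReflect_apply, if_neg (not_le.2 hgt)] at this
      simp [Matrix.sub_apply, hij, hij.symm] at this
      linarith
  · intro h y
    have hd : a.val = Matrix.diagonal fun i => a.val i i := by
      ext i j
      by_cases hij : i = j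
      · subst hij; simp
      · rw [h i j hij, Matrix.diagonal_apply_ne _ hij]
    apply Subtype.ext
    rw [sl_lie_val, Rsl_val, Rsl_val, sl_lie_val, hd]
    ext i j
    simp only [borelReflect_apply, Matrix.sub_apply, Matrix.mul_diagonal, Matrix.diagonal_mul]
    split_ifs <;> ring

/-- The last `m` diagonal entries of a cocycle in `sl(m + 1, ℝ)`. -/
def cocycleDiagTail (m : ℕ) : slCocycles (m + 1) →ₗ[ℝ] (Fin m → ℝ) where
  toFun a i := a.val.val i.succ i.succ
  map_add' _ _ := rfl
  map_smul' _ _ := rfl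

theorem cocycleDiagTail_bijective (m : ℕ) : Function.Bijective (cocycleDiagTail m) := by
  constructor
  · rw [← LinearMap.ker_eq_bot, LinearMap.ker_eq_bot']
    intro a ha
    have hs : ∀ i : Fin m, a.val.val i.succ i.succ = 0 := congrFun ha
    have htr : Matrix.trace a.val.val = 0 := a.val.2
    have h0 : a.val.val 0 0 = 0 := by
      simpa [Matrix.trace, Fin.sum_univ_succ, hs] using htr
    apply Subtype.ext
    apply Subtype.ext
    ext i j
    by_cases hij : i = j
    · subst hij
      exact Fin.cases h0 hs i
    · exact (isCocycle_iff_diagonal _ a.val).1 a.2 i j hij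
  · intro v
    let d : Fin (m + 1) → ℝ := Fin.cons (-∑ i, v i) v
    have hd : (Matrix.diagonal d).trace = 0 := by
      simp [d, Matrix.trace_diagonal, Fin.sum_univ_succ]
    refine ⟨⟨slOfTrace _ hd, (isCocycle_iff_diagonal _ _).2
      fun i j hij => Matrix.diagonal_apply_ne _ hij⟩, ?_⟩
    ext i
    change Matrix.diagonal d i.succ i.succ = v i
    simp [d]

/-- For `n ≥ 2`, the map `R` (identity on the Borel subalgebra, minus identity on
strictly lower-triangular matrices) is a modified `r`-matrix on `sl(n, ℝ)`; an element
`a ∈ sl(n, ℝ)` satisfies `d_R a = 0` iff `a` is diagonal, and consequently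
`H¹(R) ≅ ℝ^{n-1}`. -/
theorem sl_first_cohomology
    (n : ℕ) (hn : 2 ≤ n) :
    (∀ x y : LieAlgebra.SpecialLinear.sl (Fin n) ℝ,
      ⁅Rsl n x, Rsl n y⁆ = Rsl n (⁅Rsl n x, y⁆ + ⁅x, Rsl n y⁆) - ⁅x, y⁆) ∧
    (∀ a : LieAlgebra.SpecialLinear.sl (Fin n) ℝ,
      (∀ y : LieAlgebra.SpecialLinear.sl (Fin n) ℝ, ⁅Rsl n y, a⁆ = Rsl n ⁅y, a⁆)
        ↔ (∀ i j : Fin n, i ≠ j → a.val i j = 0)) ∧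
    Nonempty ((slCocycles n) ≃ₗ[ℝ] (Fin (n - 1) → ℝ)) := by
  refine ⟨Rsl_modified_yang_baxter n, isCocycle_iff_diagonal n, ?_⟩
  obtain ⟨m, rfl⟩ : ∃ m, n = m + 1 := ⟨n - 1, by omega⟩
  exact ⟨LinearEquiv.ofBijective (cocycleDiagTail m) (cocycleDiagTail_bijective m)⟩

end
end
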